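/- Let k ≤ n be positive integers. There exists a ℚ-linear bijection e between R_{n,k} and the free ℚ-vector space with basis the set of surjections f : {1, …, n} → {1, …, k}, such that e intertwines the two S_n-actions: the action of σ ∈ S_n on R_{n,k} induced by the variable permutation x_i ↦ x_{σ(i)} (which is well defined since the ideal I_{n,k} is stable under variable permutations), and the action on basis elements given by f ↦ f ∘ σ^{−1}. In other words, R_{n,k} is isomorphic as an ungraded S_n-module to the permutation module ℚ[OP_{n,k}]. -/

import Mathlib

open MvPolynomial

/-- The ideal `I_{n,k} ⊆ ℚ[x_1, …, x_n]` generated by `x_1^k, …, x_n^k` together with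
the elementary symmetric polynomials `e_d(x_1, …, x_n)` for `n−k+1 ≤ d ≤ n`. -/
noncomputable def Ink (n k : ℕ) : Ideal (MvPolynomial (Fin n) ℚ) :=
  Ideal.span ({p | ∃ i : Fin n, p = X i ^ k} ∪
    {p | ∃ d : ℕ, n - k + 1 ≤ d ∧ d ≤ n ∧ p = esymm (Fin n) ℚ d})

/-- The ideal generated by the `x_i^k` and the elementary symmetric polynomials of degree
greater than `n - s`. -/
noncomputable def powEsymmIdeal (n k s : ℕ) : Ideal (MvPolynomial (Fin n) ℚ) :=
  Ideal.span ({p | ∃ i : Fin n, p = X i ^ k} ∪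
    {p | ∃ d : ℕ, n < d + s ∧ p = esymm (Fin n) ℚ d})

/-- The number of maps from an `n`-set to a `k`-set whose range contains a given `s`-set. -/
def coveringCount (k : ℕ) : ℕ → ℕ → ℕ
  | 0, s => if s = 0 then 1 else 0
  | n + 1, s => s * coveringCount k n (s - 1) + (k - s) * coveringCount k n s

theorem card_covering (k n : ℕ) (T : Finset (Fin k)) :
    Nat.card {f : Fin n → Fin k // ∀ j ∈ T, ∃ i, f i = j} = coveringCount k n T.card := by
  classical
  induction n generalizing T with
  | zero =>
    rw [coveringCount]
    split_ifs with h
    · obtain rfl := Finset.card_eq_zero.mp h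
      simp
    · obtain ⟨j, hj⟩ := Finset.card_ne_zero.mp h
      have : IsEmpty {f : Fin 0 → Fin k // ∀ j ∈ T, ∃ i, f i = j} :=
        ⟨fun f => (f.2 j hj).choose.elim0⟩
      exact Nat.card_of_isEmpty
  | succ n ih =>
    have e : {f : Fin (n + 1) → Fin k // ∀ j ∈ T, ∃ i, f i = j} ≃
        Σ a : Fin k, {g : Fin n → Fin k // ∀ j ∈ T.erase a, ∃ i, g i = j} :=
      { toFun := fun f => ⟨f.1 0, Fin.tail f.1, fun j hj => by
          obtain ⟨hne, hj⟩ := Finset.mem_erase.mp hj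
          obtain ⟨i, hi⟩ := f.2 j hj
          induction i using Fin.cases with
          | zero => exact absurd hi.symm hne
          | succ i => exact ⟨i, hi⟩⟩
        invFun := fun g => ⟨Fin.cons g.1 g.2.1, fun j hj => by
          by_cases h : j = g.1
          · exact ⟨0, h.symm⟩
          · obtain ⟨i, hi⟩ := g.2.2 j (Finset.mem_erase.mpr ⟨h, hj⟩)
            exact ⟨i.succ, hi⟩⟩
        left_inv := fun f => Subtype.ext (Fin.cons_self_tail f.1)
        right_inv := fun g => rfl }
    rw [Nat.card_congr e, Nat.card_sigma]
    simp_rw [ih]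
    rw [← Finset.sum_add_sum_compl T]
    have h1 : ∀ a ∈ T, coveringCount k n (T.erase a).card = coveringCount k n (T.card - 1) :=
      fun a ha => by rw [Finset.card_erase_of_mem ha]
    have h2 : ∀ a ∈ Tᶜ, coveringCount k n (T.erase a).card = coveringCount k n T.card :=
      fun a ha => by rw [Finset.erase_eq_of_notMem (Finset.mem_compl.mp ha)]
    rw [Finset.sum_congr rfl h1, Finset.sum_congr rfl h2]
    simp [coveringCount, Finset.card_compl]

theorem esymm_fin_succ (n d : ℕ) :
    esymm (Fin (n + 1)) ℚ (d + 1) = rename Fin.succ (esymm (Fin n) ℚ (d + 1)) +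
      X 0 * rename Fin.succ (esymm (Fin n) ℚ d) := by
  have h (m : ℕ) : rename Fin.succ (esymm (Fin n) ℚ m) =
      (Finset.univ.val.map fun i : Fin n => (X i.succ : MvPolynomial (Fin (n + 1)) ℚ)).esymm m := by
    have hr : rename Fin.succ =
        aeval (R := ℚ) (X ∘ Fin.succ : Fin n → MvPolynomial (Fin (n + 1)) ℚ) := by
      ext i
      simp
    rw [hr]
    exact aeval_esymm_eq_multiset_esymm (Fin n) ℚ m (X ∘ Fin.succ)
  have hu : (Finset.univ.val.map fun i : Fin (n + 1) => (X i : MvPolynomial (Fin (n + 1)) ℚ)) =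
      X 0 ::ₘ Finset.univ.val.map fun i : Fin n => X i.succ := by
    simp [Fin.univ_succ, Function.comp_def]
  rw [h, h, esymm_eq_multiset_esymm, hu]
  generalize Finset.univ.val.map (fun i : Fin n => (X i.succ : MvPolynomial (Fin (n + 1)) ℚ)) = t
  simp [Multiset.esymm, Multiset.powersetCard_cons, Multiset.sum_map_mul_left]

theorem esymm_eq_zero_of_lt {n d : ℕ} (h : n < d) : esymm (Fin n) ℚ d = 0 := by
  rw [esymm, Finset.powersetCard_eq_empty.mpr (by simpa using h), Finset.sum_empty]

theorem X_pow_mem_powEsymmIdeal {n : ℕ} (k s : ℕ) (i : Fin n) :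
    X i ^ k ∈ powEsymmIdeal n k s :=
  Ideal.subset_span (Or.inl ⟨i, rfl⟩)

theorem esymm_mem_powEsymmIdeal {n s d : ℕ} (k : ℕ) (h : n < d + s) :
    esymm (Fin n) ℚ d ∈ powEsymmIdeal n k s :=
  Ideal.subset_span (Or.inr ⟨d, h, rfl⟩)

theorem X_zero_pow_mul_rename_esymm_mem {n k s : ℕ} (j d : ℕ) (hj : j ≤ s) (hd : n + 1 ≤ d + j) :
    X 0 ^ j * rename Fin.succ (esymm (Fin n) ℚ d) ∈ powEsymmIdeal (n + 1) k s := by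
  induction j generalizing d with
  | zero => simp [esymm_eq_zero_of_lt (show n < d by omega)]
  | succ j ih =>
    have h : X 0 ^ (j + 1) * rename Fin.succ (esymm (Fin n) ℚ d) =
        X 0 ^ j * esymm (Fin (n + 1)) ℚ (d + 1) -
          X 0 ^ j * rename Fin.succ (esymm (Fin n) ℚ (d + 1)) := by
      rw [esymm_fin_succ]; ring
    rw [h]
    exact sub_mem (Ideal.mul_mem_left _ _ (esymm_mem_powEsymmIdeal k (by omega)))
      (ih (d + 1) (by omega) (by omega))

theorem X_zero_pow_mul_rename_mem {n k s : ℕ} {q : MvPolynomial (Fin n) ℚ}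
    (hq : q ∈ powEsymmIdeal n k s) :
    X 0 ^ s * rename Fin.succ q ∈ powEsymmIdeal (n + 1) k s := by
  induction hq using Submodule.span_induction with
  | mem q hq =>
    rcases hq with ⟨i, rfl⟩ | ⟨d, hd, rfl⟩
    · rw [map_pow, rename_X]
      exact Ideal.mul_mem_left _ _ (X_pow_mem_powEsymmIdeal k s _)
    · exact X_zero_pow_mul_rename_esymm_mem s d le_rfl (by omega)
  | zero => simp
  | add p q _ _ hp hq => rw [map_add, mul_add]; exact add_mem hp hq
  | smul a q _ hq =>
    rw [smul_eq_mul, map_mul, mul_left_comm]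
    exact Ideal.mul_mem_left _ _ hq

theorem exists_rename_sub_X_zero_mul_mem {n k s : ℕ} {q : MvPolynomial (Fin n) ℚ}
    (hq : q ∈ powEsymmIdeal n k s) :
    ∃ r, rename Fin.succ q - X 0 * r ∈ powEsymmIdeal (n + 1) k (s + 1) := by
  induction hq using Submodule.span_induction with
  | mem q hq =>
    rcases hq with ⟨i, rfl⟩ | ⟨d, hd, rfl⟩
    · refine ⟨0, ?_⟩
      rw [map_pow, rename_X, mul_zero, sub_zero]
      exact X_pow_mem_powEsymmIdeal k _ _
    · rcases d with _ | d
      · refine ⟨0, ?_⟩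
        have := esymm_mem_powEsymmIdeal (n := n + 1) (s := s + 1) (d := 0) k (by omega)
        simpa using this
      · refine ⟨-rename Fin.succ (esymm (Fin n) ℚ d), ?_⟩
        rw [mul_neg, sub_neg_eq_add, ← esymm_fin_succ]
        exact esymm_mem_powEsymmIdeal k (by omega)
  | zero => exact ⟨0, by simp⟩
  | add p q _ _ hp hq =>
    obtain ⟨r, hr⟩ := hp
    obtain ⟨t, ht⟩ := hq
    refine ⟨r + t, ?_⟩
    convert add_mem hr ht using 1
    rw [map_add]; ring
  | smul a q _ hq =>
    obtain ⟨r, hr⟩ := hq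
    refine ⟨rename Fin.succ a * r, ?_⟩
    convert Ideal.mul_mem_left _ (rename Fin.succ a) hr using 1
    rw [smul_eq_mul, map_mul]; ring

theorem exists_eq_rename_succ_add_X_zero_mul {n : ℕ} (p : MvPolynomial (Fin (n + 1)) ℚ) :
    ∃ q r, p = rename Fin.succ q + X 0 * r := by
  induction p using MvPolynomial.induction_on with
  | C a => exact ⟨C a, 0, by simp⟩
  | add p₁ p₂ h₁ h₂ =>
    obtain ⟨q₁, r₁, rfl⟩ := h₁
    obtain ⟨q₂, r₂, rfl⟩ := h₂
    exact ⟨q₁ + q₂, r₁ + r₂, by rw [map_add]; ring⟩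
  | mul_X p i h =>
    obtain ⟨q, r, rfl⟩ := h
    induction i using Fin.cases with
    | zero => exact ⟨0, rename Fin.succ q + X 0 * r, by rw [map_zero]; ring⟩
    | succ i => exact ⟨q * X i, r * X i.succ, by rw [map_mul, rename_X]; ring⟩

theorem exists_finset_span_sup_powEsymmIdeal (k n s : ℕ) (hs : s ≤ k) :
    ∃ B : Finset (MvPolynomial (Fin n) ℚ), B.card ≤ coveringCount k n s ∧
      ∀ p, p ∈ Submodule.span ℚ (B : Set (MvPolynomial (Fin n) ℚ)) ⊔
        (powEsymmIdeal n k s).restrictScalars ℚ := by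
  classical
  induction n generalizing s with
  | zero =>
    by_cases h : s = 0
    · subst h
      refine ⟨{1}, by simp [coveringCount], fun p => Submodule.mem_sup_left ?_⟩
      rw [Finset.coe_singleton, Submodule.mem_span_singleton, eq_C_of_isEmpty p]
      exact ⟨coeff 0 p, by rw [smul_eq_C_mul, mul_one]⟩
    · refine ⟨∅, by simp, fun p => Submodule.mem_sup_right ?_⟩
      have h1 := esymm_mem_powEsymmIdeal (n := 0) (s := s) (d := 0) k (by omega)
      rw [esymm_zero] at h1
      simpa using Ideal.mul_mem_left _ p h1
  | succ n ih =>
    obtain ⟨B₁, hB₁, hp₁⟩ := ih (s - 1) (by omega)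
    obtain ⟨B₂, hB₂, hp₂⟩ := ih s hs
    let m : ℕ × MvPolynomial (Fin n) ℚ → MvPolynomial (Fin (n + 1)) ℚ :=
      fun x => X 0 ^ x.1 * rename Fin.succ x.2
    let B := (Finset.range s ×ˢ B₁).image m ∪ (Finset.Ico s k ×ˢ B₂).image m
    have hBcard : B.card ≤ coveringCount k (n + 1) s := by
      refine (Finset.card_union_le _ _).trans (add_le_add ?_ ?_)
      · refine Finset.card_image_le.trans ?_
        rw [Finset.card_product, Finset.card_range]
        exact Nat.mul_le_mul_left _ hB₁
      · refine Finset.card_image_le.trans ?_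
        rw [Finset.card_product, Nat.card_Ico]
        exact Nat.mul_le_mul_left _ hB₂
    refine ⟨B, hBcard, ?_⟩
    set W := Submodule.span ℚ (B : Set (MvPolynomial (Fin (n + 1)) ℚ)) ⊔
        (powEsymmIdeal (n + 1) k s).restrictScalars ℚ with hW
    have hI : ∀ p ∈ powEsymmIdeal (n + 1) k s, p ∈ W := fun p hp => Submodule.mem_sup_right hp
    have hspan : ∀ (i : ℕ) (B' : Finset (MvPolynomial (Fin n) ℚ)), (∀ b ∈ B', m (i, b) ∈ B) →
        ∀ b ∈ Submodule.span ℚ (B' : Set (MvPolynomial (Fin n) ℚ)),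
          X 0 ^ i * rename Fin.succ b ∈ W := by
      intro i B' hB' b hb
      refine Submodule.mem_sup_left ?_
      induction hb using Submodule.span_induction with
      | mem b hb => exact Submodule.subset_span (hB' b hb)
      | zero => simp
      | add p q _ _ hp hq => rw [map_add, mul_add]; exact add_mem hp hq
      | smul a q _ hq =>
        rw [map_smul, mul_smul_comm]
        exact Submodule.smul_mem _ _ hq
    have key : ∀ j ≤ k, ∀ p, X 0 ^ (k - j) * p ∈ W := by
      intro j
      induction j with
      | zero => exact fun _ p => hI _ (Ideal.mul_mem_right _ _ (X_pow_mem_powEsymmIdeal k s 0))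
      | succ j ihj =>
        intro hj p
        obtain ⟨i, hi⟩ : ∃ i, i = k - (j + 1) := ⟨_, rfl⟩
        have hij : k - j = i + 1 := by omega
        rw [← hi]
        have ihj' := ihj (by omega)
        rw [hij] at ihj'
        obtain ⟨q, r, rfl⟩ := exists_eq_rename_succ_add_X_zero_mul p
        rw [mul_add, ← mul_assoc, ← pow_succ]
        refine add_mem ?_ (ihj' r)
        by_cases his : i < s
        · obtain ⟨b, hb, t, ht, rfl⟩ := Submodule.mem_sup.mp (hp₁ q)
          rw [map_add, mul_add]
          refine add_mem (hspan i B₁ (fun b hb => Finset.mem_union_left _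
            (Finset.mem_image_of_mem _ (by simp [his, hb]))) b hb) ?_
          obtain ⟨c, hc⟩ := exists_rename_sub_X_zero_mul_mem ht
          rw [Nat.sub_add_cancel (by omega)] at hc
          have : X 0 ^ i * rename Fin.succ t =
              X 0 ^ i * (rename Fin.succ t - X 0 * c) + X 0 ^ (i + 1) * c := by ring
          rw [this]
          exact add_mem (hI _ (Ideal.mul_mem_left _ _ hc)) (ihj' c)
        · obtain ⟨b, hb, t, ht, rfl⟩ := Submodule.mem_sup.mp (hp₂ q)
          rw [map_add, mul_add]
          refine add_mem (hspan i B₂ (fun b hb => Finset.mem_union_right _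
            (Finset.mem_image_of_mem _ (by simp [hb]; omega))) b hb) ?_
          rw [← Nat.sub_add_cancel (not_lt.mp his), pow_add, mul_assoc]
          exact hI _ (Ideal.mul_mem_left _ _ (X_zero_pow_mul_rename_mem ht))
    intro p
    simpa using key k le_rfl p

theorem powEsymmIdeal_le_Ink (n k : ℕ) (hkn : k ≤ n) : powEsymmIdeal n k k ≤ Ink n k := by
  refine Ideal.span_le.mpr ?_
  rintro p (⟨i, rfl⟩ | ⟨d, hd, rfl⟩)
  · exact Ideal.subset_span (Or.inl ⟨i, rfl⟩)
  · by_cases h : d ≤ n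
    · exact Ideal.subset_span (Or.inr ⟨d, by omega, h, rfl⟩)
    · rw [esymm_eq_zero_of_lt (not_le.mp h)]
      exact zero_mem _

theorem card_surjective_eq_coveringCount (n k : ℕ) :
    Nat.card {f : Fin n → Fin k // Function.Surjective f} = coveringCount k n k := by
  have := card_covering k n Finset.univ
  simpa [Function.Surjective] using this

/-- `Ink n k` has a complement spanned by at most as many polynomials as there are surjections. -/
theorem exists_finset_span_sup_Ink (n k : ℕ) (hkn : k ≤ n) :
    ∃ B : Finset (MvPolynomial (Fin n) ℚ),
      B.card ≤ Nat.card {f : Fin n → Fin k // Function.Surjective f} ∧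
      ∀ p, p ∈ Submodule.span ℚ (B : Set (MvPolynomial (Fin n) ℚ)) ⊔
        (Ink n k).restrictScalars ℚ := by
  obtain ⟨B, hB, hp⟩ := exists_finset_span_sup_powEsymmIdeal k n k le_rfl
  refine ⟨B, card_surjective_eq_coveringCount n k ▸ hB, fun p => ?_⟩
  exact sup_le_sup_left (show (powEsymmIdeal n k k).restrictScalars ℚ ≤
    (Ink n k).restrictScalars ℚ from powEsymmIdeal_le_Ink n k hkn) _ (hp p)

/-- Averaging a projection over the group yields an equivariant projection. -/
theorem exists_equivariant_projection {G V : Type*} [Group G] [Finite G] [AddCommGroup V]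
    [Module ℚ V] (ρ : Representation ℚ G V) (F : Submodule ℚ V)
    (hF : ∀ g, ∀ v ∈ F, ρ g v ∈ F) :
    ∃ P : V →ₗ[ℚ] V, (∀ v, P v ∈ F) ∧ (∀ v ∈ F, P v = v) ∧ ∀ g v, P (ρ g v) = ρ g (P v) := by
  cases nonempty_fintype G
  obtain ⟨π, hπ⟩ := F.subtype.exists_leftInverse_of_injective F.ker_subtype
  have hcard : (Fintype.card G : ℚ) ≠ 0 := Nat.cast_ne_zero.mpr Fintype.card_ne_zero
  refine ⟨(Fintype.card G : ℚ)⁻¹ • ∑ g, ρ g⁻¹ ∘ₗ F.subtype ∘ₗ π ∘ₗ ρ g, ?_, ?_, ?_⟩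
  · intro v
    simp only [LinearMap.smul_apply, LinearMap.sum_apply, LinearMap.comp_apply]
    exact F.smul_mem _ (sum_mem fun g _ => hF _ _ (π _).2)
  · intro v hv
    have h (g : G) : (π (ρ g v) : V) = ρ g v :=
      congrArg Subtype.val (DFunLike.congr_fun hπ ⟨ρ g v, hF g v hv⟩)
    simp only [LinearMap.smul_apply, LinearMap.sum_apply, LinearMap.comp_apply,
      Submodule.subtype_apply, h, Representation.inv_self_apply, Finset.sum_const,
      Finset.card_univ]
    rw [← Nat.cast_smul_eq_nsmul ℚ, smul_smul, inv_mul_cancel₀ hcard, one_smul]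
  · intro g v
    simp only [LinearMap.smul_apply, LinearMap.sum_apply, LinearMap.comp_apply, map_smul, map_sum]
    congr 1
    refine Fintype.sum_equiv (Equiv.mulRight g) _ _ fun h => ?_
    simp only [Equiv.coe_mulRight, mul_inv_rev, map_mul, Module.End.mul_apply,
      Representation.self_inv_apply]

section Evaluation

variable (n k : ℕ)

/-- Evaluation of polynomials at the points with coordinates `f i`, for `f` a surjection. -/
noncomputable def evalSurj :
    MvPolynomial (Fin n) ℚ →ₐ[ℚ] ({f : Fin n → Fin k // Function.Surjective f} → ℚ) :=
  aeval fun i f => ((f.1 i : ℕ) : ℚ)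

/-- The permutation representation on functions on surjections. -/
def surjRep : Representation ℚ (Equiv.Perm (Fin n))
    ({f : Fin n → Fin k // Function.Surjective f} → ℚ) where
  toFun σ := LinearMap.funLeft ℚ ℚ fun f => ⟨f.1 ∘ σ, f.2.comp σ.surjective⟩
  map_one' := rfl
  map_mul' _ _ := rfl

/-- The span of the homogeneous polynomials of degree less than `d`. -/
noncomputable def lowDegree (d : ℕ) : Submodule ℚ (MvPolynomial (Fin n) ℚ) :=
  Submodule.span ℚ {p | ∃ m < d, p.IsHomogeneous m}

variable {n k}

theorem mem_lowDegree {p : MvPolynomial (Fin n) ℚ} {m d : ℕ} (hp : p.IsHomogeneous m)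
    (h : m < d) : p ∈ lowDegree n d :=
  Submodule.subset_span ⟨m, h, hp⟩

theorem mul_mem_lowDegree {q r : MvPolynomial (Fin n) ℚ} {m d : ℕ} (hq : q.IsHomogeneous m)
    (hr : r ∈ lowDegree n d) : q * r ∈ lowDegree n (m + d) := by
  induction hr using Submodule.span_induction with
  | mem r hr =>
    obtain ⟨j, hj, hr⟩ := hr
    exact mem_lowDegree (hq.mul hr) (by omega)
  | zero => simp
  | add p q _ _ hp hq => rw [mul_add]; exact add_mem hp hq
  | smul a q _ hq =>
    rw [mul_smul_comm]
    exact Submodule.smul_mem _ _ hq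

theorem rename_mem_lowDegree (σ : Equiv.Perm (Fin n)) {p : MvPolynomial (Fin n) ℚ} {d : ℕ}
    (hp : p ∈ lowDegree n d) : rename σ p ∈ lowDegree n d := by
  induction hp using Submodule.span_induction with
  | mem r hr =>
    obtain ⟨j, hj, hr⟩ := hr
    exact mem_lowDegree hr.rename_isHomogeneous hj
  | zero => simp
  | add p q _ _ hp hq => rw [map_add]; exact add_mem hp hq
  | smul a q _ hq =>
    rw [map_smul]
    exact Submodule.smul_mem _ _ hq

theorem evalSurj_apply (p : MvPolynomial (Fin n) ℚ)
    (f : {f : Fin n → Fin k // Function.Surjective f}) :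
    evalSurj n k p f = aeval (fun i => ((f.1 i : ℕ) : ℚ)) p := by
  have : (Pi.evalAlgHom ℚ (fun _ => ℚ) f).comp (evalSurj n k) =
      aeval fun i => ((f.1 i : ℕ) : ℚ) := by
    ext i
    simp [evalSurj]
  exact DFunLike.congr_fun this p

theorem evalSurj_rename (σ : Equiv.Perm (Fin n)) (p : MvPolynomial (Fin n) ℚ) :
    evalSurj n k (rename σ p) = surjRep n k σ (evalSurj n k p) := by
  ext f
  rw [evalSurj_apply, aeval_rename]
  exact (evalSurj_apply p ⟨f.1 ∘ σ, f.2.comp σ.surjective⟩).symm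

theorem evalSurj_surjective : Function.Surjective (evalSurj n k) := by
  classical
  intro v
  let ind (f : Fin n → Fin k) : MvPolynomial (Fin n) ℚ :=
    ∏ i, ∏ j ∈ Finset.univ.erase (f i), (X i - C ((j : ℕ) : ℚ))
  have h0 (f g : {f : Fin n → Fin k // Function.Surjective f}) (hfg : g ≠ f) :
      evalSurj n k (ind f.1) g = 0 := by
    obtain ⟨i, hi⟩ := Function.ne_iff.mp fun h => hfg (Subtype.ext h)
    rw [evalSurj_apply]
    simp only [ind, map_prod, map_sub, aeval_X, aeval_C]
    refine Finset.prod_eq_zero (Finset.mem_univ i) (Finset.prod_eq_zero (i := g.1 i) ?_ ?_)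
    · simpa using hi
    · simp
  have h1 (f : {f : Fin n → Fin k // Function.Surjective f}) :
      evalSurj n k (ind f.1) f ≠ 0 := by
    rw [evalSurj_apply]
    simp only [ind, map_prod, map_sub, aeval_X, aeval_C]
    refine Finset.prod_ne_zero_iff.mpr fun i _ => Finset.prod_ne_zero_iff.mpr fun j hj => ?_
    have hj := Finset.ne_of_mem_erase hj
    simpa [sub_eq_zero, Fin.val_inj] using hj.symm
  refine ⟨∑ f : {f : Fin n → Fin k // Function.Surjective f},
    (v f / evalSurj n k (ind f.1) f) • ind f.1, ?_⟩
  ext g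
  rw [map_sum, Finset.sum_apply, Finset.sum_eq_single g]
  · rw [map_smul, Pi.smul_apply, smul_eq_mul, div_mul_cancel₀ _ (h1 g)]
  · intro f _ hfg
    rw [map_smul, Pi.smul_apply, h0 f g hfg.symm, smul_zero]
  · simp

theorem exists_lowDegree_evalSurj_X_pow (i : Fin n) :
    ∃ r ∈ lowDegree n k, evalSurj n k (X i ^ k) = evalSurj n k r := by
  let A : Polynomial ℚ := ∏ j : Fin k, (Polynomial.X - Polynomial.C ((j : ℕ) : ℚ))
  have hA : A.Monic := Polynomial.monic_prod_X_sub_C _ _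
  have hdeg : A.natDegree = k := by
    rw [Polynomial.natDegree_prod_of_monic _ _ fun _ _ => Polynomial.monic_X_sub_C _]
    simp only [Polynomial.natDegree_X_sub_C, Finset.sum_const, Finset.card_univ, Fintype.card_fin,
      smul_eq_mul, mul_one]
  refine ⟨-∑ j ∈ Finset.range k, A.coeff j • X i ^ j, ?_, ?_⟩
  · refine neg_mem (sum_mem fun j hj => Submodule.smul_mem _ _ ?_)
    exact mem_lowDegree (isHomogeneous_X_pow i j) (Finset.mem_range.mp hj)
  · ext f
    have h : A.eval ((f.1 i : ℕ) : ℚ) = 0 := by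
      rw [Polynomial.eval_prod]
      exact Finset.prod_eq_zero (Finset.mem_univ (f.1 i)) (by simp)
    rw [hA.as_sum, hdeg] at h
    simp only [Polynomial.eval_add, Polynomial.eval_pow, Polynomial.eval_X,
      Polynomial.eval_finsetSum, Polynomial.eval_mul, Polynomial.eval_C] at h
    rw [evalSurj_apply, evalSurj_apply]
    simp only [map_neg, map_sum, map_smul, map_pow, aeval_X, smul_eq_mul]
    linarith

theorem esymm_isHomogeneous (n d : ℕ) : (esymm (Fin n) ℚ d).IsHomogeneous d := by
  refine IsHomogeneous.sum _ _ _ fun t ht => ?_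
  have := IsHomogeneous.prod t (fun i => (X i : MvPolynomial (Fin n) ℚ)) (fun _ => 1)
    fun i _ => isHomogeneous_X ℚ i
  simpa [(Finset.mem_powersetCard.mp ht).2] using this

theorem exists_lowDegree_evalSurj_esymm (hkn : k ≤ n) {d : ℕ} (h1 : n - k + 1 ≤ d) (h2 : d ≤ n) :
    ∃ r ∈ lowDegree n d, evalSurj n k (esymm (Fin n) ℚ d) = evalSurj n k r := by
  classical
  let A : Polynomial ℚ := ∏ j : Fin k, (Polynomial.X + Polynomial.C ((j : ℕ) : ℚ))
  have hA : A.Monic := Polynomial.monic_prod_of_monic _ _ fun _ _ => Polynomial.monic_X_add_C _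
  have hdeg : A.natDegree = k := by
    rw [Polynomial.natDegree_prod_of_monic _ _ fun _ _ => Polynomial.monic_X_add_C _]
    simp only [Polynomial.natDegree_X_add_C, Finset.sum_const, Finset.card_univ, Fintype.card_fin,
      smul_eq_mul, mul_one]
  let c (j : ℕ) : ℚ := ((Polynomial.X ^ (n - j) : Polynomial ℚ) %ₘ A).coeff (n - d)
  refine ⟨-∑ j ∈ Finset.range (n - k + 1), c j • esymm (Fin n) ℚ j, ?_, ?_⟩
  · refine neg_mem (sum_mem fun j hj => Submodule.smul_mem _ _ ?_)
    exact mem_lowDegree (esymm_isHomogeneous n j) (by have := Finset.mem_range.mp hj; omega)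
  · ext f
    have hdvd : A ∣ ((Finset.univ.val.map fun i => ((f.1 i : ℕ) : ℚ)).map
        fun r => Polynomial.X + Polynomial.C r).prod := by
      obtain ⟨g, hg⟩ := f.2.hasRightInverse
      rw [Multiset.map_map]
      have : A = ∏ i ∈ Finset.univ.map ⟨g, hg.injective⟩,
          (Polynomial.X + Polynomial.C ((f.1 i : ℕ) : ℚ)) := by
        rw [Finset.prod_map]
        simp [A, hg _]
      rw [this]
      exact Finset.prod_dvd_prod_of_subset _ _ _ (Finset.subset_univ _)
    have hmod := (Polynomial.modByMonic_eq_zero_iff_dvd hA).mpr hdvd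
    rw [Multiset.prod_X_add_C_eq_sum_esymm] at hmod
    simp only [Multiset.card_map, Finset.card_val, Finset.card_univ, Fintype.card_fin] at hmod
    have hsum : ∑ j ∈ Finset.range (n + 1),
        c j * evalSurj n k (esymm (Fin n) ℚ j) f = 0 := by
      have := congrArg (fun q => Polynomial.coeff q (n - d)) hmod
      change (Polynomial.modByMonicHom A _).coeff _ = _ at this
      rw [map_sum, Polynomial.finsetSum_coeff] at this
      rw [← Polynomial.coeff_zero (n - d), ← this]
      refine Finset.sum_congr rfl fun j _ => ?_
      rw [← Polynomial.smul_eq_C_mul, map_smul, Polynomial.coeff_smul, smul_eq_mul, mul_comm,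
        evalSurj_apply, aeval_esymm_eq_multiset_esymm]
      rfl
    have hc (j : ℕ) (hj : j ∈ Finset.Ico (n - k + 1) (n + 1)) :
        c j = if n - d = n - j then 1 else 0 := by
      have := Finset.mem_Ico.mp hj
      simp only [c]
      rw [(Polynomial.modByMonic_eq_self_iff hA).mpr, Polynomial.coeff_X_pow]
      rw [Polynomial.degree_X_pow, Polynomial.degree_eq_natDegree hA.ne_zero, hdeg]
      exact_mod_cast (by omega : n - j < k)
    rw [← Finset.sum_range_add_sum_Ico _ (show n - k + 1 ≤ n + 1 by omega),
      Finset.sum_eq_single_of_mem d (Finset.mem_Ico.mpr ⟨h1, by omega⟩)] at hsum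
    · have hc : c d = 1 := by rw [hc d (Finset.mem_Ico.mpr ⟨h1, by omega⟩), if_pos rfl]
      rw [hc] at hsum
      simp only [map_neg, map_sum, map_smul, Pi.neg_apply, Finset.sum_apply, Pi.smul_apply,
        smul_eq_mul]
      linarith
    · intro j hj hjd
      have := Finset.mem_Ico.mp hj
      rw [hc j hj, if_neg (by omega), zero_mul]

theorem exists_lowDegree_evalSurj_generator (hkn : k ≤ n) {g : MvPolynomial (Fin n) ℚ}
    (hg : g ∈ {p | ∃ i : Fin n, p = X i ^ k} ∪
      {p | ∃ d : ℕ, n - k + 1 ≤ d ∧ d ≤ n ∧ p = esymm (Fin n) ℚ d}) :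
    ∃ d, g.IsHomogeneous d ∧ ∃ r ∈ lowDegree n d, evalSurj n k g = evalSurj n k r := by
  rcases hg with ⟨i, rfl⟩ | ⟨d, h1, h2, rfl⟩
  · exact ⟨k, isHomogeneous_X_pow i k, exists_lowDegree_evalSurj_X_pow i⟩
  · exact ⟨d, esymm_isHomogeneous n d, exists_lowDegree_evalSurj_esymm hkn h1 h2⟩

/-- Splitting the degree filtration equivariantly turns evaluation into a map that only sees
leading forms. -/
theorem exists_equivariant_leadingForm_map (n k : ℕ) (hkn : k ≤ n) :
    ∃ ψ : MvPolynomial (Fin n) ℚ →ₗ[ℚ] ({f : Fin n → Fin k // Function.Surjective f} → ℚ),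
      Function.Surjective ψ ∧ (∀ p ∈ Ink n k, ψ p = 0) ∧
      ∀ (σ : Equiv.Perm (Fin n)) p, ψ (rename σ p) = surjRep n k σ (ψ p) := by
  have hproj (d : ℕ) := exists_equivariant_projection (surjRep n k)
    ((lowDegree n d).map (evalSurj n k).toLinearMap) (by
      rintro σ _ ⟨p, hp, rfl⟩
      exact ⟨rename σ p, rename_mem_lowDegree σ hp, evalSurj_rename σ p⟩)
  choose P hPmem hPid hPcomm using hproj
  let ψ := (basisMonomials (Fin n) ℚ).constr ℚ fun s =>
    evalSurj n k (monomial s 1) - P s.degree (evalSurj n k (monomial s 1))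
  have hmon (s : Fin n →₀ ℕ) (a : ℚ) : ψ (monomial s a) =
      evalSurj n k (monomial s a) - P s.degree (evalSurj n k (monomial s a)) := by
    have h : monomial s a = a • basisMonomials (Fin n) ℚ s := by simp [smul_monomial]
    have hb : ψ (basisMonomials (Fin n) ℚ s) = _ := Module.Basis.constr_basis _ _ _ _
    rw [h, map_smul, hb, map_smul, map_smul, smul_sub, coe_basisMonomials]
  have hhom {p : MvPolynomial (Fin n) ℚ} {m : ℕ} (hp : p.IsHomogeneous m) :
      ψ p = evalSurj n k p - P m (evalSurj n k p) := by
    rw [p.as_sum]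
    simp only [map_sum, ← Finset.sum_sub_distrib]
    refine Finset.sum_congr rfl fun s hs => ?_
    rw [hmon, hp.degree_eq_sum_deg_support hs]
    rfl
  refine ⟨ψ, ?_, ?_, ?_⟩
  · have hrange : ∀ m (p : MvPolynomial (Fin n) ℚ), p.IsHomogeneous m →
        evalSurj n k p ∈ LinearMap.range ψ := by
      intro m
      induction m using Nat.strong_induction_on with
      | _ m ih =>
        intro p hp
        have hlow : (lowDegree n m).map (evalSurj n k).toLinearMap ≤ LinearMap.range ψ := by
          rw [lowDegree, Submodule.map_span, Submodule.span_le]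
          rintro _ ⟨q, ⟨j, hj, hq⟩, rfl⟩
          exact ih j hj q hq
        have : evalSurj n k p = ψ p + P m (evalSurj n k p) := by rw [hhom hp, sub_add_cancel]
        rw [this]
        exact add_mem ⟨p, rfl⟩ (hlow (hPmem m _))
    intro v
    obtain ⟨p, rfl⟩ := evalSurj_surjective v
    rw [← LinearMap.mem_range, p.as_sum, map_sum]
    exact sum_mem fun s _ => hrange _ _ (isHomogeneous_monomial _ rfl)
  · have hkill : ∀ p ∈ Ink n k, ∀ q, ψ (q * p) = 0 := by
      intro p hp
      induction hp using Submodule.span_induction with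
      | mem g hg =>
        obtain ⟨d, hgd, r, hr, hgr⟩ := exists_lowDegree_evalSurj_generator hkn hg
        intro q
        induction q using MvPolynomial.induction_on' with
        | monomial s a =>
          have hs := isHomogeneous_monomial (R := ℚ) a (n := s.degree) (d := s) rfl
          rw [hhom (hs.mul hgd), hPid, sub_self]
          exact ⟨monomial s a * r, mul_mem_lowDegree hs hr, by simp [hgr]⟩
        | add q₁ q₂ h₁ h₂ => rw [add_mul, map_add, h₁, h₂, add_zero]
      | zero => simp
      | add p₁ p₂ _ _ h₁ h₂ => intro q; rw [mul_add, map_add, h₁, h₂, add_zero]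
      | smul a p _ h => intro q; rw [smul_eq_mul, ← mul_assoc]; exact h _
    intro p hp
    simpa using hkill p hp 1
  · intro σ p
    induction p using MvPolynomial.induction_on' with
    | monomial s a =>
      have hs := isHomogeneous_monomial (R := ℚ) a (n := s.degree) (d := s) rfl
      rw [hhom hs, hhom (hs.rename_isHomogeneous (f := σ)), evalSurj_rename, hPcomm, map_sub]
    | add p q hp hq => rw [map_add, map_add, hp, hq, map_add, map_add]

end Evaluation

/-- `R_{n,k} ≅ ℚ[OP_{n,k}]` as ungraded `S_n`-modules: there is a `ℚ`-linear bijection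
between the quotient `R_{n,k} = ℚ[x_1, …, x_n]/I_{n,k}` and the free `ℚ`-vector space on
the surjections `f : {1,…,n} → {1,…,k}` (realized as the function space, since the basis is
finite), intertwining the action of `σ ∈ S_n` by `x_i ↦ x_{σ(i)}` (i.e. `rename σ`) on the
quotient with the action `f ↦ f ∘ σ⁻¹` on basis elements; equivalently, for a vector `v`
in the function-space model, `(σ • v) f = v (f ∘ σ)`. -/
theorem stmt9 (n k : ℕ) (hk : 1 ≤ k) (hkn : k ≤ n) :
    ∃ e : (MvPolynomial (Fin n) ℚ ⧸ Ink n k) ≃ₗ[ℚ]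
        ({f : Fin n → Fin k // Function.Surjective f} → ℚ),
      ∀ (σ : Equiv.Perm (Fin n)) (p : MvPolynomial (Fin n) ℚ)
        (f : {f : Fin n → Fin k // Function.Surjective f}),
        e (Ideal.Quotient.mk (Ink n k) (rename σ p)) f
          = e (Ideal.Quotient.mk (Ink n k) p) ⟨f.1 ∘ σ, f.2.comp σ.surjective⟩ := by
  obtain ⟨ψ, hsurj, hker, hσ⟩ := exists_equivariant_leadingForm_map n k hkn
  obtain ⟨B, hB, hspan⟩ := exists_finset_span_sup_Ink n k hkn
  let φ : (MvPolynomial (Fin n) ℚ ⧸ Ink n k) →ₗ[ℚ]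
      ({f : Fin n → Fin k // Function.Surjective f} → ℚ) :=
    ((Ink n k).restrictScalars ℚ).liftQ ψ hker ∘ₗ
      (Submodule.Quotient.restrictScalarsEquiv ℚ (Ink n k)).symm.toLinearMap
  have hφ (p : MvPolynomial (Fin n) ℚ) : φ (Ideal.Quotient.mk (Ink n k) p) = ψ p := rfl
  have hφs : Function.Surjective φ := fun v => by
    obtain ⟨p, rfl⟩ := hsurj v
    exact ⟨_, hφ p⟩
  let mk := (Ideal.Quotient.mkₐ ℚ (Ink n k)).toLinearMap
  have htop : (⊤ : Submodule ℚ (MvPolynomial (Fin n) ℚ ⧸ Ink n k)) =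
      Submodule.span ℚ (mk '' B) := by
    refine (eq_top_iff.mpr fun x _ => ?_).symm
    obtain ⟨p, rfl⟩ := Ideal.Quotient.mk_surjective x
    obtain ⟨b, hb, t, ht, rfl⟩ := Submodule.mem_sup.mp (hspan p)
    rw [map_add, Ideal.Quotient.eq_zero_iff_mem.mpr ht, add_zero, ← Submodule.map_span]
    exact ⟨b, hb, rfl⟩
  classical
  have hfin : Module.Finite ℚ (MvPolynomial (Fin n) ℚ ⧸ Ink n k) :=
    ⟨⟨B.image mk, by rw [Finset.coe_image, htop]⟩⟩
  have hle : Module.finrank ℚ (MvPolynomial (Fin n) ℚ ⧸ Ink n k) ≤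
      Module.finrank ℚ ({f : Fin n → Fin k // Function.Surjective f} → ℚ) := by
    rw [← finrank_top, htop, ← Finset.coe_image, Module.finrank_fintype_fun_eq_card,
      ← Nat.card_eq_fintype_card]
    exact (finrank_span_finset_le_card _).trans (Finset.card_image_le.trans hB)
  have heq := hle.antisymm (LinearMap.finrank_le_finrank_of_surjective hφs)
  refine ⟨LinearEquiv.ofBijective φ
    ⟨(LinearMap.injective_iff_surjective_of_finrank_eq_finrank heq).mpr hφs, hφs⟩,
    fun σ p f => ?_⟩
  exact congrFun (hσ σ p) f
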